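/- arXiv:0801.3260 — 2 statements merged into one kernel-verified Lean document; each statement's English description precedes it below -/
import Mathlib

section
/- Let (V, Y_V, c) be a graded vertex coalgebra, M a ℚ-graded vector space with a map Y_M satisfying all the axioms of a comodule over V except possibly the Jacobi identity but satisfying weak coassociativity. Then (e^{x_0 D*} ⊗ Id_M) Y_M(x_2) = Y_M(x_2 + x_0), where D* = (Id_V ⊗ c)Δ_{-2} and Y_M(x_2 + x_0) is expanded in nonnegative integral powers of x_0. -/
/- Common background for the formalization of "Vertex coalgebras, comodules,
cocommutativity and coassociativity" (K. Hubbard).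

A vertex coalgebra `(V, Y, c)` is encoded by the family of coefficient maps
`Δ k : V →ₗ V ⊗ V` of the coproduct `Y(x)v = ∑ₖ Δ k v · x^(-k-1)` together with
the covacuum `c : V →ₗ F`.  All identities of formal series are encoded
coefficient-wise; in particular the Jacobi identity is encoded by its
(dual Borcherds) coefficient form. -/

noncomputable section

open scoped TensorProduct

variable (F : Type) [Field F] [CharZero F]

/-- The generalized binomial coefficient `(a choose i)` as an element of `F`. -/
def gchoose (a : ℤ) (i : ℕ) : F :=
  (∏ j ∈ Finset.range i, ((a : F) - (j : F))) / (Nat.factorial i : F)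

variable {V M : Type} [AddCommGroup V] [Module F V] [AddCommGroup M] [Module F M]

/-- `c ⊗ Id` composed with the canonical identification `F ⊗ M ≃ M`. -/
def cLeft (c : V →ₗ[F] F) : V ⊗[F] M →ₗ[F] M :=
  (TensorProduct.lid F M).toLinearMap ∘ₗ TensorProduct.map c LinearMap.id

/-- `Id ⊗ c` composed with the canonical identification `V ⊗ F ≃ V`. -/
def cRight (c : M →ₗ[F] F) : V ⊗[F] M →ₗ[F] V :=
  (TensorProduct.rid F V).toLinearMap ∘ₗ TensorProduct.map LinearMap.id c

/-- The transposition `T ⊗ Id` of the first two tensor factors of `V ⊗ (V ⊗ M)`. -/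
def Tfirst : V ⊗[F] (V ⊗[F] M) →ₗ[F] V ⊗[F] (V ⊗[F] M) :=
  (TensorProduct.assoc F V V M).toLinearMap ∘ₗ
    TensorProduct.map (TensorProduct.comm F V V).toLinearMap LinearMap.id ∘ₗ
    (TensorProduct.assoc F V V M).symm.toLinearMap

/-- The coefficient of `x₁^(-m-1) x₂^(-n-1)` in `(Id ⊗ Y(x₂)) Y(x₁)`. -/
def comp12 (ΔM : ℤ → M →ₗ[F] V ⊗[F] M) (m n : ℤ) : M →ₗ[F] V ⊗[F] (V ⊗[F] M) :=
  TensorProduct.map LinearMap.id (ΔM n) ∘ₗ ΔM m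

/-- The coefficient of `x₀^(-m-1) x₂^(-n-1)` in `(Y(x₀) ⊗ Id) Y(x₂)`. -/
def compR (ΔV : ℤ → V →ₗ[F] V ⊗[F] V) (ΔM : ℤ → M →ₗ[F] V ⊗[F] M) (m n : ℤ) :
    M →ₗ[F] V ⊗[F] (V ⊗[F] M) :=
  (TensorProduct.assoc F V V M).toLinearMap ∘ₗ TensorProduct.map (ΔV m) LinearMap.id ∘ₗ ΔM n

/-- The coefficient form of the (comodule) Jacobi identity of a vertex coalgebra,
obtained by extracting the coefficient of `x₀^(-a-1) x₁^(-b-1) x₂^(-c-1)`. -/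
def JacobiId (ΔV : ℤ → V →ₗ[F] V ⊗[F] V) (ΔM : ℤ → M →ₗ[F] V ⊗[F] M) : Prop :=
  ∀ (a b c : ℤ) (w : M),
    (∑ᶠ i : ℕ, ((-1 : F) ^ i * gchoose F a i) •
        (comp12 F ΔM (a + b - i) (c + i) w -
          (-1 : F) ^ a • Tfirst F (comp12 F ΔM (a + c - i) (b + i) w))) =
      ∑ᶠ i : ℕ, gchoose F b i • compR F ΔV ΔM (a + i) (b + c - i) w

/-- The axioms of a vertex coalgebra except the Jacobi identity: left counit,
cocreation and truncation, in coefficient form. -/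
def IsVertexCoalgSansJacobi (Δ : ℤ → V →ₗ[F] V ⊗[F] V) (c : V →ₗ[F] F) : Prop :=
  (∀ v : V, cLeft F c (Δ (-1) v) = v) ∧
  (∀ k : ℤ, k ≠ -1 → ∀ v : V, cLeft F c (Δ k v) = 0) ∧
  (∀ v : V, cRight F c (Δ (-1) v) = v) ∧
  (∀ k : ℤ, 0 ≤ k → ∀ v : V, cRight F c (Δ k v) = 0) ∧
  (∀ v : V, ∃ N : ℤ, ∀ k : ℤ, k < N → Δ k v = 0)

/-- The axioms of a vertex coalgebra. -/
def IsVertexCoalg (Δ : ℤ → V →ₗ[F] V ⊗[F] V) (c : V →ₗ[F] F) : Prop :=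
  IsVertexCoalgSansJacobi F Δ c ∧ JacobiId F Δ Δ

/-- The weight-`m` component of `V ⊗ V` for a graded space `V`. -/
def grT2 (gr : ℤ → Submodule F V) (m : ℤ) : Submodule F (V ⊗[F] V) :=
  ⨆ p : ℤ, LinearMap.range (TensorProduct.map (gr p).subtype (gr (m - p)).subtype)

/-- The weight-`m` component of `V ⊗ (V ⊗ V)` for a graded space `V`. -/
def grT3 (gr : ℤ → Submodule F V) (m : ℤ) : Submodule F (V ⊗[F] (V ⊗[F] V)) :=
  ⨆ p : ℤ × ℤ, LinearMap.range (TensorProduct.map (gr p.1).subtype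
    (TensorProduct.map (gr p.2).subtype (gr (m - p.1 - p.2)).subtype))

/-- The grading axioms of a graded vertex coalgebra: `V = ⊕ₖ V₍ₖ₎` internally,
`V₍ₖ₎ = 0` for `k` sufficiently small, and `Δ k` raises weight by `k + 1`. -/
def IsGradedVC (Δ : ℤ → V →ₗ[F] V ⊗[F] V) (gr : ℤ → Submodule F V) : Prop :=
  DirectSum.IsInternal gr ∧ (∃ N : ℤ, ∀ k : ℤ, k < N → gr k = ⊥) ∧
  (∀ r k : ℤ, ∀ v ∈ gr r, Δ k v ∈ grT2 F gr (r + k + 1))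

/-- `f` belongs to the graded dual `(V^{⊗3})'`: it vanishes on all but finitely
many homogeneous components of `V ⊗ V ⊗ V`. -/
def GradedDual3 (gr : ℤ → Submodule F V) (f : V ⊗[F] (V ⊗[F] V) →ₗ[F] F) : Prop :=
  ∃ s : Finset ℤ, ∀ m : ℤ, m ∉ s → ∀ u ∈ grT3 F gr m, f u = 0

/-- The weight-`q` component of `V ⊗ M` for `V` a `ℤ`-graded space and
`M` a `ℚ`-graded space. -/
def grVM (gr : ℤ → Submodule F V) (grM : ℚ → Submodule F M) (q : ℚ) :
    Submodule F (V ⊗[F] M) :=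
  ⨆ p : ℤ, LinearMap.range (TensorProduct.map (gr p).subtype (grM (q - p)).subtype)

/-- The weight-`q` component of `V ⊗ (V ⊗ M)`. -/
def grVVM (gr : ℤ → Submodule F V) (grM : ℚ → Submodule F M) (q : ℚ) :
    Submodule F (V ⊗[F] (V ⊗[F] M)) :=
  ⨆ p : ℤ × ℤ, LinearMap.range (TensorProduct.map (gr p.1).subtype
    (TensorProduct.map (gr p.2).subtype (grM (q - p.1 - p.2)).subtype))

/-- `f` belongs to the graded dual `(V ⊗ V ⊗ M)'`. -/
def GradedDualVVM (gr : ℤ → Submodule F V) (grM : ℚ → Submodule F M)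
    (f : V ⊗[F] (V ⊗[F] M) →ₗ[F] F) : Prop :=
  ∃ s : Finset ℚ, ∀ q : ℚ, q ∉ s → ∀ u ∈ grVVM F gr grM q, f u = 0

/-- The axioms of a comodule over a graded vertex coalgebra, except the Jacobi
identity: left counit, truncation, internal `ℚ`-grading bounded below, and the
grading condition on the comodule coproduct. -/
def IsComoduleSansJacobi (c : V →ₗ[F] F) (ΔM : ℤ → M →ₗ[F] V ⊗[F] M)
    (gr : ℤ → Submodule F V) (grM : ℚ → Submodule F M) : Prop :=
  (∀ w : M, cLeft F c (ΔM (-1) w) = w) ∧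
  (∀ k : ℤ, k ≠ -1 → ∀ w : M, cLeft F c (ΔM k w) = 0) ∧
  (∀ w : M, ∃ N : ℤ, ∀ k : ℤ, k < N → ΔM k w = 0) ∧
  DirectSum.IsInternal grM ∧ (∃ N : ℚ, ∀ q : ℚ, q < N → grM q = ⊥) ∧
  (∀ (j : ℚ) (k : ℤ), ∀ w ∈ grM j, ΔM k w ∈ grVM F gr grM (j + k + 1))

/-- Weak cocommutativity with exponent `k`, paired against `f`, coefficient-wise:
the coefficient of `x₁^(-b-1) x₂^(-c-1)` in
`(x₁-x₂)^k ⟨f, (Id ⊗ Y(x₂))Y(x₁)w - (T ⊗ Id)(Id ⊗ Y(x₁))Y(x₂)w⟩` vanishes. -/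
def WeakCocom (ΔM : ℤ → M →ₗ[F] V ⊗[F] M) (f : V ⊗[F] (V ⊗[F] M) →ₗ[F] F)
    (k : ℕ) : Prop :=
  ∀ (w : M) (b c : ℤ),
    ∑ j ∈ Finset.range (k + 1), ((-1 : F) ^ j * (k.choose j : F)) *
      (f (comp12 F ΔM (b + k - j) (c + j) w) -
        f (Tfirst F (comp12 F ΔM (c + j) (b + k - j) w))) = 0

/-- Weak coassociativity with exponent `k`, paired against `f`, coefficient-wise:
the coefficient of `x₀^(-a-1) x₂^(-c-1)` in
`(x₀+x₂)^k ⟨f, (Y(x₀) ⊗ Id)Y(x₂)w - (Id ⊗ Y(x₂))Y(x₀+x₂)w⟩` vanishes,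
`Y(x₀+x₂)` being expanded in nonnegative integral powers of `x₂`. -/
def WeakCoassoc (ΔV : ℤ → V →ₗ[F] V ⊗[F] V) (ΔM : ℤ → M →ₗ[F] V ⊗[F] M)
    (f : V ⊗[F] (V ⊗[F] M) →ₗ[F] F) (k : ℕ) : Prop :=
  ∀ (w : M) (a c : ℤ),
    ∑ j ∈ Finset.range (k + 1), (k.choose j : F) *
      (f (compR F ΔV ΔM (a + k - j) (c + j) w) -
        ∑ᶠ i : ℕ, ((-1 : F) ^ i * gchoose F (a + k - j) i) *
          f (comp12 F ΔM (a + k - j - i) (c + j + i) w)) = 0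

/-- The coefficient function of `x^r y^s (x + ε y)^t · A`, where `A : ℤ → ℤ → F`
is the coefficient function of a formal series (`A m n` is the coefficient of
`x^m y^n`). -/
def mulPoly (r s t : ℕ) (ε : F) (A : ℤ → ℤ → F) (m n : ℤ) : F :=
  ∑ j ∈ Finset.range (t + 1), (t.choose j : F) * ε ^ j *
    A (m - (r : ℤ) - ((t - j : ℕ) : ℤ)) (n - (s : ℤ) - (j : ℤ))

/-- `g` is the coefficient function of a polynomial in two variables. -/
def IsPolyCoeff (g : ℤ → ℤ → F) : Prop :=
  {p : ℤ × ℤ | g p.1 p.2 ≠ 0}.Finite ∧ ∀ m n : ℤ, m < 0 ∨ n < 0 → g m n = 0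

/-- The coefficient function of the polynomial `h(x₁ - x₂, x₂)` in the
variables `x₁, x₂`, given the coefficient function of `h = h(x₀, x₂)`. -/
def substC (h : ℤ → ℤ → F) (m n : ℤ) : F :=
  ∑ᶠ j : ℕ, ((-1 : F) ^ j * gchoose F (m + j) j) * h (m + j) (n - j)

/-- The coefficient form of the Jacobi identity of a vertex algebra (the
Borcherds identity). -/
def VAJacobi (mul : ℤ → V →ₗ[F] V →ₗ[F] V) : Prop :=
  ∀ (a b c : ℤ) (u v w : V),
    (∑ᶠ i : ℕ, ((-1 : F) ^ i * gchoose F a i) •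
        (mul (a + b - i) u (mul (c + i) v w) -
          (-1 : F) ^ a • mul (a + c - i) v (mul (b + i) u w))) =
      ∑ᶠ i : ℕ, gchoose F b i • mul (b + c - i) (mul (a + i) u v) w

/-- The axioms of a vertex algebra: truncation, vacuum, creation and the Jacobi
identity, in coefficient form (`mul n u v` is `u_n v`). -/
def IsVA (mul : ℤ → V →ₗ[F] V →ₗ[F] V) (one : V) : Prop :=
  (∀ u v : V, ∃ N : ℤ, ∀ n : ℤ, N < n → mul n u v = 0) ∧
  (∀ v : V, mul (-1) one v = v) ∧
  (∀ n : ℤ, n ≠ -1 → ∀ v : V, mul n one v = 0) ∧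
  (∀ v : V, mul (-1) v one = v) ∧
  (∀ n : ℤ, 0 ≤ n → ∀ v : V, mul n v one = 0) ∧
  VAJacobi F mul

/-- The graded dual `V' = ⊕ₖ V₍ₖ₎*`, realized as the submodule of the full dual
consisting of functionals vanishing on all but finitely many components. -/
def gradedDual (gr : ℤ → Submodule F V) : Submodule F (Module.Dual F V) where
  carrier := {φ | ∃ s : Finset ℤ, ∀ k ∉ s, ∀ u ∈ gr k, φ u = 0}
  zero_mem' := ⟨∅, by intro k _ u _; simp⟩
  add_mem' := by
    rintro a b ⟨s, hs⟩ ⟨t, ht⟩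
    refine ⟨s ∪ t, ?_⟩
    intro k hk u hu
    simp only [Finset.mem_union, not_or] at hk
    simp [LinearMap.add_apply, hs k hk.1 u hu, ht k hk.2 u hu]
  smul_mem' := by
    rintro r a ⟨s, hs⟩
    refine ⟨s, ?_⟩
    intro k hk u hu
    simp [LinearMap.smul_apply, hs k hk u hu]

/-- The weight-`k` component `V₍ₖ₎* ⊆ V'` of the graded dual: functionals
vanishing on every component of weight other than `k`. -/
def gradedDualPiece (gr : ℤ → Submodule F V) (k : ℤ) :
    Submodule F ↥(gradedDual F gr) where
  carrier := {φ | ∀ j : ℤ, j ≠ k → ∀ u ∈ gr j, (φ : Module.Dual F V) u = 0}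
  zero_mem' := by intro j _ u _; simp
  add_mem' := by
    intro a b ha hb j hj u hu
    simp [ha j hj u hu, hb j hj u hu]
  smul_mem' := by
    intro r a ha j hj u hu
    simp [ha j hj u hu]

/-- The natural pairing of `V' ⊗ V'` with `V ⊗ V`. -/
def pairVV (gr : ℤ → Submodule F V) :
    ↥(gradedDual F gr) ⊗[F] ↥(gradedDual F gr) →ₗ[F] Module.Dual F (V ⊗[F] V) :=
  TensorProduct.dualDistrib F V V ∘ₗ
    TensorProduct.map (gradedDual F gr).subtype (gradedDual F gr).subtype

/-- The covacuum map on the graded dual: evaluation at the vacuum. -/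
def covac (gr : ℤ → Submodule F V) (one : V) : ↥(gradedDual F gr) →ₗ[F] F :=
  LinearMap.applyₗ one ∘ₗ (gradedDual F gr).subtype

/-- A bilinear form `B` on `V` extended componentwise to `V ⊗ V`. -/
def formT2 (B : V →ₗ[F] V →ₗ[F] F) : V ⊗[F] V →ₗ[F] Module.Dual F (V ⊗[F] V) :=
  TensorProduct.dualDistrib F V V ∘ₗ TensorProduct.map B B

set_option linter.unusedSectionVars false

theorem gchoose_eq_choose (a : ℤ) (i : ℕ) : gchoose F a i = Ring.choose (a : F) i := by
  rw [Ring.choose_eq_smul, ← Polynomial.aeval_eq_smeval, Polynomial.aeval_def,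
    Polynomial.eval₂_eq_eval_map, descPochhammer_map, descPochhammer_eval_eq_prod_range, gchoose,
    div_eq_inv_mul, smul_eq_mul]

theorem neg_one_pow_mul_gchoose (a : ℤ) (i : ℕ) :
    (-1 : F) ^ i * gchoose F a i = gchoose F (i - a - 1) i := by
  have h : ∏ j ∈ Finset.range i, (((i - a - 1 : ℤ) : F) - (j : F)) =
      ∏ j ∈ Finset.range i, (-1 : F) * ((a : F) - (j : F)) := by
    rw [← Finset.prod_range_reflect]
    refine Finset.prod_congr rfl fun j hj => ?_
    have hj' : j + 1 ≤ i := Finset.mem_range.1 hj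
    rw [Nat.sub_sub, Nat.cast_sub (by omega)]
    push_cast
    ring
  rw [gchoose, gchoose, h, Finset.prod_mul_distrib, Finset.prod_const, Finset.card_range,
    mul_div_assoc]

theorem sum_choose_mul_gchoose (k d : ℕ) :
    ∑ j ∈ Finset.range (k + 1), (if j ≤ d then (k.choose j : F) * gchoose F (d + 1 - k) (d - j)
      else 0) = d + 1 := by
  have h := Ring.add_choose_eq (r := (k : F)) (s := ((d + 1 - k : ℤ) : F)) d (Commute.all _ _)
  rw [Finset.Nat.sum_antidiagonal_eq_sum_range_succ_mk] at h
  have hs : (k : F) + ((d + 1 - k : ℤ) : F) = ((d + 1 : ℕ) : F) := by push_cast; ring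
  rw [hs, Ring.choose_natCast, Nat.choose_succ_self_right] at h
  push_cast at h
  rw [h, ← Finset.sum_filter]
  simp only [Ring.choose_natCast, gchoose_eq_choose]
  push_cast
  refine Finset.sum_subset_zero_on_sdiff (fun j hj => ?_) (fun j hj => ?_) (fun _ _ => rfl)
  · simp only [Finset.mem_filter, Finset.mem_range] at hj ⊢
    omega
  · simp only [Finset.mem_sdiff, Finset.mem_filter, Finset.mem_range] at hj
    rw [Nat.choose_eq_zero_of_lt (by omega), Nat.cast_zero, zero_mul]

/-- The coefficient of `x₀` in the solution `A` of
`(x₀ + x₂)^k (A(x₀, x₂) - α(x₀ + x₂)) = 0`, where `A` has no negative powers of `x₀`. -/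
theorem coeff_shift_of_weak_assoc (A : ℤ → ℤ → F) (α : ℤ → F)
    (hA : ∀ m n, 0 ≤ m → A m n = 0) (hAα : ∀ n, A (-1) n = α n) (k : ℕ) (hk : 0 < k)
    (h : ∀ a c : ℤ, ∑ j ∈ Finset.range (k + 1), (k.choose j : F) * (A (a + k - j) (c + j) -
      ∑ᶠ i : ℕ, ((-1 : F) ^ i * gchoose F (a + k - j) i) *
        (if c + j + i = -1 then α (a + k - j - i) else 0)) = 0) (n : ℤ) :
    A (-2) n = -(n : F) * α (n - 1) := by
  have hfin : ∀ (a c : ℤ) (j : ℕ), ∑ᶠ i : ℕ, ((-1 : F) ^ i * gchoose F (a + k - j) i) *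
      (if c + j + i = -1 then α (a + k - j - i) else 0) =
      if c + j ≤ -1 then gchoose F (-c - 1 - a - k - 1) (-1 - c - j).toNat * α (a + k + c + 1)
        else 0 := by
    intro a c j
    split_ifs with hc
    · obtain ⟨i, hi⟩ := Int.eq_ofNat_of_zero_le (show 0 ≤ -1 - c - j by omega)
      rw [finsum_eq_single _ i, if_pos (by omega), neg_one_pow_mul_gchoose, hi, Int.toNat_natCast]
      · congr 2 <;> omega
      · intro i' hi'
        rw [if_neg (by omega), mul_zero]
    · refine finsum_eq_zero_of_forall_eq_zero fun i => ?_
      rw [if_neg (by omega), mul_zero]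
  simp only [hfin] at h
  have hα : ∀ m : ℤ, k ≤ m → α m = 0 := by
    intro m hm
    have h0 := h (m - k) (-1)
    rw [Finset.sum_range_succ', Finset.sum_eq_zero] at h0
    · rw [hA _ _ (by push_cast; omega)] at h0
      simpa [gchoose] using h0
    · intro j hj
      have hj' := Finset.mem_range.1 hj
      rw [hA _ _ (by push_cast; omega), if_neg (by push_cast; omega), sub_zero, mul_zero]
  have hA2 : ∀ c : ℤ, ∑ j ∈ Finset.range (k + 1), (k.choose j : F) * A (-2 + k - j) (c + j) =
      k * α (c + k - 1) + A (-2) (c + k) := by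
    intro c
    obtain ⟨K, rfl⟩ : ∃ K, k = K + 1 := ⟨k - 1, by omega⟩
    rw [Finset.sum_range_succ, Finset.sum_range_succ, Finset.sum_eq_zero, zero_add,
      Nat.choose_self, Nat.choose_succ_self_right, ← hAα]
    · push_cast
      rw [one_mul]
      congr 3 <;> ring
    · intro j hj
      have hj' := Finset.mem_range.1 hj
      rw [hA _ _ (by push_cast; omega), mul_zero]
  have h2 := h (-2) (n - k)
  simp only [mul_sub, Finset.sum_sub_distrib] at h2
  rw [hA2, sub_add_cancel] at h2
  rcases le_or_gt (k : ℤ) n with hn | hn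
  · rw [Finset.sum_eq_zero (s := Finset.range (k + 1)) (f := fun j => _ * ite _ _ _)] at h2
    · rcases hn.eq_or_lt with rfl | hn
      · push_cast
        linear_combination h2
      · rw [hα (n - 1) (by omega)] at h2 ⊢
        linear_combination h2
    · intro j _
      rw [if_neg (by omega), mul_zero]
  · obtain ⟨d, hd⟩ := Int.eq_ofNat_of_zero_le (show 0 ≤ k - n - 1 by omega)
    obtain rfl : n = k - d - 1 := by omega
    have hS : ∑ j ∈ Finset.range (k + 1), (k.choose j : F) *
        (if (k - d - 1 - k + j : ℤ) ≤ -1 then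
          gchoose F (-(k - d - 1 - k) - 1 - -2 - k - 1) (-1 - (k - d - 1 - k) - j : ℤ).toNat *
            α (-2 + k + (k - d - 1 - k) + 1) else 0) = (d + 1) * α (k - d - 1 - 1) := by
      rw [← sum_choose_mul_gchoose F k d, Finset.sum_mul]
      refine Finset.sum_congr rfl fun j _ => ?_
      by_cases hj : j ≤ d
      · rw [if_pos (by omega), if_pos hj, ← mul_assoc]
        have h1 : (-(k - d - 1 - k) - 1 - -2 - k - 1 : ℤ) = d + 1 - k := by ring
        have h2 : (-1 - (k - d - 1 - k) - j : ℤ).toNat = d - j := by omega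
        have h3 : (-2 + k + (k - d - 1 - k) + 1 : ℤ) = k - d - 1 - 1 := by ring
        rw [h1, h2, h3]
      · rw [if_neg (by omega), if_neg hj, mul_zero, zero_mul]
    rw [hS] at h2
    push_cast
    linear_combination h2

/-- The projection of an internally graded module onto one component. -/
theorem DirectSum.IsInternal.exists_projection {R ι E : Type*} [Ring R] [DecidableEq ι]
    [AddCommGroup E] [Module R E] {A : ι → Submodule R E} (h : DirectSum.IsInternal A) (s : ι) :
    ∃ P : E →ₗ[R] E, (∀ v ∈ A s, P v = v) ∧ ∀ r, r ≠ s → ∀ v ∈ A r, P v = 0 := by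
  let e := LinearEquiv.ofBijective (DirectSum.coeLinearMap A) h
  refine ⟨(A s).subtype ∘ₗ DirectSum.component R ι (fun i => A i) s ∘ₗ e.symm.toLinearMap, ?_, ?_⟩
  · intro v hv
    change ((e.symm v s : A s) : E) = v
    rw [h.ofBijective_coeLinearMap_of_mem hv]
  · intro r hr v hv
    change ((e.symm v s : A s) : E) = 0
    rw [h.ofBijective_coeLinearMap_of_mem_ne hr hv, ZeroMemClass.coe_zero]

theorem iSup_range_tensor_ext {N : Type*} [AddCommGroup N] [Module F N] {ι : Type*}
    (A : ι → Submodule F V) (B : ι → Submodule F M) {f g : V ⊗[F] M →ₗ[F] N}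
    (h : ∀ p, ∀ a ∈ A p, ∀ b ∈ B p, f (a ⊗ₜ b) = g (a ⊗ₜ b)) {u : V ⊗[F] M}
    (hu : u ∈ ⨆ p, LinearMap.range (TensorProduct.map (A p).subtype (B p).subtype)) :
    f u = g u := by
  refine (iSup_le fun p => ?_ : _ ≤ LinearMap.eqLocus f g) hu
  rintro _ ⟨t, rfl⟩
  change (f ∘ₗ TensorProduct.map (A p).subtype (B p).subtype) t =
    (g ∘ₗ TensorProduct.map (A p).subtype (B p).subtype) t
  congr 1
  ext a b
  exact h p a a.2 b b.2

theorem dualDistrib_cRight (φ : V →ₗ[F] F) (c : M →ₗ[F] F) (t : V ⊗[F] M) :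
    TensorProduct.dualDistrib F V M (φ ⊗ₜ c) t = φ (cRight F c t) := by
  induction t with
  | zero => simp
  | tmul a b => simp [cRight, mul_comm]
  | add a b ha hb => simp only [map_add, ha, hb]

theorem dualDistrib_cLeft (c : V →ₗ[F] F) (ψ : M →ₗ[F] F) (t : V ⊗[F] M) :
    TensorProduct.dualDistrib F V M (c ⊗ₜ ψ) t = ψ (cLeft F c t) := by
  induction t with
  | zero => simp
  | tmul a b => simp [cLeft]
  | add a b ha hb => simp only [map_add, ha, hb]

/-- The covacuum of a graded vertex coalgebra has weight zero. -/
theorem covacuum_eq_zero_of_mem {Δ : ℤ → V →ₗ[F] V ⊗[F] V} {c : V →ₗ[F] F}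
    {gr : ℤ → Submodule F V} (hV : IsVertexCoalgSansJacobi F Δ c) (hgr : IsGradedVC F Δ gr)
    {r : ℤ} (hr : r ≠ 0) {v : V} (hv : v ∈ gr r) : c v = 0 := by
  obtain ⟨hL, -, hR, -, -⟩ := hV
  obtain ⟨hint, -, hΔ⟩ := hgr
  obtain ⟨P, hP, hP'⟩ := hint.exists_projection r
  obtain ⟨Q, hQ, hQ'⟩ := hint.exists_projection 0
  have hmem := hΔ r (-1) v hv
  rw [neg_add_cancel_right] at hmem
  have key : TensorProduct.dualDistrib F V V ((c ∘ₗ P) ⊗ₜ c) (Δ (-1) v) =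
      TensorProduct.dualDistrib F V V (c ⊗ₜ (c ∘ₗ Q)) (Δ (-1) v) := by
    refine iSup_range_tensor_ext F _ _ (fun p a ha b hb => ?_) hmem
    by_cases hp : p = r
    · subst hp
      rw [sub_self] at hb
      simp [hP a ha, hQ b hb]
    · simp [hP' p hp a ha, hQ' (r - p) (by omega) b hb]
  rw [dualDistrib_cRight, dualDistrib_cLeft, hR, hL] at key
  simpa [hP v hv, hQ' r hr v hv] using key

/-- An element of a tensor product of graded spaces vanishes if it is annihilated by all tensor
products of homogeneous functionals. -/
theorem tensor_eq_zero_of_homogeneous_dual {ι κ : Type*} [DecidableEq ι] [DecidableEq κ]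
    {A : ι → Submodule F V} {B : κ → Submodule F M}
    (hA : DirectSum.IsInternal A) (hB : DirectSum.IsInternal B) {u : V ⊗[F] M}
    (h : ∀ (p : ι) (q : κ) (φ : V →ₗ[F] F) (ψ : M →ₗ[F] F),
      (∀ r, r ≠ p → ∀ v ∈ A r, φ v = 0) → (∀ r, r ≠ q → ∀ w ∈ B r, ψ w = 0) →
      TensorProduct.dualDistrib F V M (φ ⊗ₜ ψ) u = 0) : u = 0 := by
  let bA := hA.collectedBasis fun i => Module.Basis.ofVectorSpace F (A i)
  let bB := hB.collectedBasis fun i => Module.Basis.ofVectorSpace F (B i)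
  refine (bA.tensorProduct bB).ext_elem fun ⟨i, j⟩ => ?_
  have hcoord : (bA.tensorProduct bB).coord (i, j) =
      TensorProduct.dualDistrib F V M (bA.coord i ⊗ₜ bB.coord j) := by
    ext a b
    simp [Module.Basis.tensorProduct_repr_tmul_apply, mul_comm]
  rw [map_zero, Finsupp.zero_apply, ← Module.Basis.coord_apply, hcoord]
  exact h i.1 j.1 _ _ (fun r hr v hv => hA.collectedBasis_repr_of_mem_ne _ hr hv)
    (fun r hr w hw => hB.collectedBasis_repr_of_mem_ne _ hr hw)

theorem map_cLeft_compR (c : V →ₗ[F] F) (ΔV : ℤ → V →ₗ[F] V ⊗[F] V)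
    (ΔM : ℤ → M →ₗ[F] V ⊗[F] M) (m n : ℤ) (w : M) :
    TensorProduct.map LinearMap.id (cLeft F c) (compR F ΔV ΔM m n w) =
      TensorProduct.map (cRight F c ∘ₗ ΔV m) LinearMap.id (ΔM n w) := by
  have h : TensorProduct.map LinearMap.id (cLeft F c) ∘ₗ
      (TensorProduct.assoc F V V M).toLinearMap =
      TensorProduct.map (cRight F c) LinearMap.id := by
    ext a b m
    simp [cLeft, cRight, TensorProduct.smul_tmul]
  change (TensorProduct.map LinearMap.id (cLeft F c) ∘ₗ
    (TensorProduct.assoc F V V M).toLinearMap) (TensorProduct.map (ΔV m) LinearMap.id (ΔM n w)) = _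
  rw [h, ← LinearMap.comp_apply, ← TensorProduct.map_comp, LinearMap.id_comp]

theorem map_cLeft_comp12 {c : V →ₗ[F] F} {ΔM : ℤ → M →ₗ[F] V ⊗[F] M}
    (h1 : ∀ w : M, cLeft F c (ΔM (-1) w) = w)
    (h2 : ∀ k : ℤ, k ≠ -1 → ∀ w : M, cLeft F c (ΔM k w) = 0) (m n : ℤ) (w : M) :
    TensorProduct.map LinearMap.id (cLeft F c) (comp12 F ΔM m n w) =
      if n = -1 then ΔM m w else 0 := by
  rw [comp12, LinearMap.comp_apply, ← LinearMap.comp_apply, ← TensorProduct.map_comp,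
    LinearMap.id_comp]
  split_ifs with hn
  · subst hn
    rw [show cLeft F c ∘ₗ ΔM (-1) = LinearMap.id from LinearMap.ext h1, TensorProduct.map_id,
      LinearMap.id_apply]
  · rw [show cLeft F c ∘ₗ ΔM n = 0 from LinearMap.ext (h2 n hn), TensorProduct.map_zero_right,
      LinearMap.zero_apply]

/-- Contracting the middle factor with a covacuum of weight zero gives an element of the graded
dual of `V ⊗ V ⊗ M`. -/
theorem gradedDualVVM_of_homogeneous {gr : ℤ → Submodule F V} {grM : ℚ → Submodule F M}
    {c φ : V →ₗ[F] F} {ψ : M →ₗ[F] F} {p : ℤ} {q : ℚ}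
    (hc : ∀ r, r ≠ 0 → ∀ v ∈ gr r, c v = 0) (hφ : ∀ r, r ≠ p → ∀ v ∈ gr r, φ v = 0)
    (hψ : ∀ r, r ≠ q → ∀ w ∈ grM r, ψ w = 0) :
    GradedDualVVM F gr grM (TensorProduct.dualDistrib F V M (φ ⊗ₜ ψ) ∘ₗ
      TensorProduct.map LinearMap.id (cLeft F c)) := by
  refine ⟨{p + q}, fun s hs u hu => ?_⟩
  rw [Finset.mem_singleton] at hs
  refine (iSup_le fun r => ?_ : _ ≤ LinearMap.ker _) hu
  rintro _ ⟨t, rfl⟩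
  rw [LinearMap.mem_ker, ← LinearMap.comp_apply, ← LinearMap.zero_apply (σ₁₂ := RingHom.id F) t]
  congr 1
  ext a b m
  by_cases h1 : r.1 = p
  · by_cases h2 : r.2 = 0
    · have h3 : s - r.1 - r.2 ≠ q := by
        rw [h1, h2]
        intro h
        apply hs
        rw [← h]
        push_cast
        ring
      simp [cLeft, hψ _ h3 m m.2]
    · simp [cLeft, hc _ h2 b b.2]
  · simp [cLeft, hφ _ h1 a a.2]

theorem map_Dstar_coproduct
    {ΔV : ℤ → V →ₗ[F] V ⊗[F] V} {c : V →ₗ[F] F} {gr : ℤ → Submodule F V}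
    (hV : IsVertexCoalgSansJacobi F ΔV c) (hgr : IsGradedVC F ΔV gr)
    {ΔM : ℤ → M →ₗ[F] V ⊗[F] M} {grM : ℚ → Submodule F M}
    (hmod : IsComoduleSansJacobi F c ΔM gr grM)
    (hwassoc : ∀ (f : V ⊗[F] (V ⊗[F] M) →ₗ[F] F), GradedDualVVM F gr grM f →
      ∃ k : ℕ, 0 < k ∧ WeakCoassoc F ΔV ΔM f k) (n : ℤ) (w : M) :
    TensorProduct.map (cRight F c ∘ₗ ΔV (-2)) LinearMap.id (ΔM n w) =
      -(n : F) • ΔM (n - 1) w := by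
  rw [← sub_eq_zero]
  refine tensor_eq_zero_of_homogeneous_dual F hgr.1 hmod.2.2.2.1 fun p q φ ψ hφ hψ => ?_
  obtain ⟨k, hk, hw⟩ := hwassoc _ (gradedDualVVM_of_homogeneous F
    (fun r hr v hv => covacuum_eq_zero_of_mem F hV hgr hr hv) hφ hψ)
  set g := TensorProduct.dualDistrib F V M (φ ⊗ₜ ψ)
  rw [map_sub, map_smul, sub_eq_zero, smul_eq_mul]
  obtain ⟨-, -, hR, hR', -⟩ := hV
  refine coeff_shift_of_weak_assoc F
    (fun m n => g (TensorProduct.map (cRight F c ∘ₗ ΔV m) LinearMap.id (ΔM n w)))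
    (fun n => g (ΔM n w)) (fun m n hm => ?_) (fun n => ?_) k hk (fun a b => ?_) n
  · rw [show cRight F c ∘ₗ ΔV m = 0 from LinearMap.ext (hR' m hm), TensorProduct.map_zero_left,
      LinearMap.zero_apply, map_zero]
  · rw [show cRight F c ∘ₗ ΔV (-1) = LinearMap.id from LinearMap.ext hR, TensorProduct.map_id,
      LinearMap.id_apply]
  · simpa only [LinearMap.comp_apply, map_cLeft_compR, map_cLeft_comp12 F hmod.1 hmod.2.1,
      apply_ite g, map_zero] using hw w a b

/-- Let `(V, Y_V, c)` be a graded vertex coalgebra and `M` a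
`ℚ`-graded vector space with `Y_M` satisfying all the axioms of a comodule over
`V` except possibly the Jacobi identity, but satisfying weak coassociativity.
Then `(e^{x₀ D*} ⊗ Id) Y_M(x₂) = Y_M(x₂ + x₀)`, with `Y_M(x₂+x₀)` expanded in
nonnegative integral powers of `x₀`; extracting the coefficient of
`x₂^(-k-1) x₀^p` this reads
`(1/p!) ((D*)^p ⊗ Id)(Δ_M k w) = (-1)^p (k choose p) Δ_M (k-p) w`. -/
theorem comodule_Dstar_shift
    (ΔV : ℤ → V →ₗ[F] V ⊗[F] V) (c : V →ₗ[F] F) (gr : ℤ → Submodule F V)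
    (hVC : IsVertexCoalg F ΔV c) (hgr : IsGradedVC F ΔV gr)
    (ΔM : ℤ → M →ₗ[F] V ⊗[F] M) (grM : ℚ → Submodule F M)
    (hmod : IsComoduleSansJacobi F c ΔM gr grM)
    (hwassoc : ∀ (f : V ⊗[F] (V ⊗[F] M) →ₗ[F] F), GradedDualVVM F gr grM f →
      ∃ k : ℕ, 0 < k ∧ WeakCoassoc F ΔV ΔM f k) :
    ∀ (k : ℤ) (p : ℕ) (w : M),
      (Nat.factorial p : F)⁻¹ •
          TensorProduct.map ((cRight F c ∘ₗ ΔV (-2)) ^ p) LinearMap.id (ΔM k w)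
        = ((-1 : F) ^ p * gchoose F k p) • ΔM (k - p) w := by
  intro k p w
  have hD := map_Dstar_coproduct F hVC.1 hgr hmod hwassoc
  have hpow : TensorProduct.map ((cRight F c ∘ₗ ΔV (-2)) ^ p) LinearMap.id (ΔM k w) =
      ((-1 : F) ^ p * ∏ j ∈ Finset.range p, ((k : F) - (j : F))) • ΔM (k - p) w := by
    induction p with
    | zero => simp [Module.End.one_eq_id]
    | succ p ih =>
      rw [pow_succ', Module.End.mul_eq_comp, ← LinearMap.id_comp (LinearMap.id (M := M)),
        TensorProduct.map_comp, LinearMap.comp_apply, ih, map_smul, hD, smul_smul,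
        Finset.prod_range_succ]
      congr 1
      · push_cast
        ring
      · push_cast
        rw [sub_sub]
  rw [hpow, smul_smul, gchoose]
  congr 1
  ring
end
end

section
/- (Duality between graded vertex algebras and graded vertex coalgebras.) Let F be a field of characteristic 0 and V = ⊕_{k∈ℤ}V_(k) a ℤ-graded F-vector space with V_(k) = 0 for k sufficiently small. Fix a vector 1 ∈ V_(0) and a linear map Y(·,x) : V → End(V)[[x,x^{-1}]] such that u_n v ∈ V_(j+k−n−1) for u ∈ V_(j), v ∈ V_(k), n ∈ ℤ. Let V' = ⊕_k V_(k)^* be the graded dual, define c : V' → F by c(u') = u'(1), and define Y'(x) on V' by ⟨Y'(x)u', v ⊗ w⟩ = ⟨u', Y(v,x)w⟩ for all u' ∈ V', v, w ∈ V (the grading condition on Y ensures each coefficient of Y'(x)u' lies in V' ⊗ V'). Then (V, Y, 1) is a graded vertex algebra if and only if (V', Y', c) is a graded vertex coalgebra. -/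
/- Common background for the formalization of "Vertex coalgebras, comodules,
cocommutativity and coassociativity" (K. Hubbard).

A vertex coalgebra `(V, Y, c)` is encoded by the family of coefficient maps
`Δ k : V →ₗ V ⊗ V` of the coproduct `Y(x)v = ∑ₖ Δ k v · x^(-k-1)` together with
the covacuum `c : V →ₗ F`.  All identities of formal series are encoded
coefficient-wise; in particular the Jacobi identity is encoded by its
(dual Borcherds) coefficient form. -/

noncomputable section

open scoped TensorProduct

variable (F : Type) [Field F] [CharZero F]

variable {V M : Type} [AddCommGroup V] [Module F V] [AddCommGroup M] [Module F M]

set_option linter.unusedSectionVars false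

section TensorSeparation

variable {K P Q : Type} [Field K]

/-- The product functional `p ⊗ q ↦ f p * g q` on `P ⊗ Q`. -/
def prodFunctional [AddCommMonoid P] [Module K P] [AddCommMonoid Q] [Module K Q]
    (f : P →ₗ[K] K) (g : Q →ₗ[K] K) : P ⊗[K] Q →ₗ[K] K :=
  (TensorProduct.lid K K).toLinearMap ∘ₗ TensorProduct.map f g

@[simp]
theorem prodFunctional_tmul [AddCommMonoid P] [Module K P] [AddCommMonoid Q] [Module K Q]
    (f : P →ₗ[K] K) (g : Q →ₗ[K] K) (p : P) (q : Q) :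
    prodFunctional f g (p ⊗ₜ[K] q) = f p * g q := by
  simp [prodFunctional]

variable [AddCommGroup P] [Module K P] [AddCommGroup Q] [Module K Q]

/-- Over a field, products of two separating families of functionals separate the points of the
tensor product. -/
theorem eq_zero_of_prodFunctional_eq_zero {ι κ : Type} (f : ι → P →ₗ[K] K) (g : κ → Q →ₗ[K] K)
    (hf : ∀ p, (∀ i, f i p = 0) → p = 0) (hg : ∀ q, (∀ j, g j q = 0) → q = 0)
    (t : P ⊗[K] Q) (h : ∀ i j, prodFunctional (f i) (g j) t = 0) : t = 0 := by
  have hcontract : ∀ i, TensorProduct.lid K Q ((f i).rTensor Q t) = 0 := by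
    intro i
    refine hg _ fun j => ?_
    rw [← h i j]
    exact LinearMap.congr_fun (f := g j ∘ₗ (TensorProduct.lid K Q).toLinearMap ∘ₗ (f i).rTensor Q)
      (TensorProduct.ext' fun p q => by simp) t
  let b := Module.Free.chooseBasis K Q
  apply (TensorProduct.equivFinsuppOfBasisRight b).injective
  ext k
  rw [map_zero, Finsupp.zero_apply, TensorProduct.equivFinsuppOfBasisRight_apply]
  refine hf _ fun i => ?_
  have hswap : f i ∘ₗ (TensorProduct.rid K P).toLinearMap ∘ₗ (b.coord k).lTensor P =
      b.coord k ∘ₗ (TensorProduct.lid K Q).toLinearMap ∘ₗ (f i).rTensor Q :=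
    TensorProduct.ext' fun p q => by simp [mul_comm]
  have := LinearMap.congr_fun hswap t
  simp only [LinearMap.comp_apply, LinearEquiv.coe_coe] at this
  rw [this, hcontract, map_zero]

end TensorSeparation

section Pairing

variable {F} {W : Type} [AddCommGroup W] [Module F W]

/-- Evaluation at `v ⊗ w` of elements of `W ⊗ W`, for `W` mapping to the dual of `V`. -/
def tensorEval₂ (ev : W →ₗ[F] Module.Dual F V) (v w : V) : W ⊗[F] W →ₗ[F] F :=
  prodFunctional (ev.flip v) (ev.flip w)

/-- Evaluation at `u ⊗ (v ⊗ w)` of elements of `W ⊗ (W ⊗ W)`, for `W` mapping to the dual of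
`V`. -/
def tensorEval₃ (ev : W →ₗ[F] Module.Dual F V) (u v w : V) : W ⊗[F] (W ⊗[F] W) →ₗ[F] F :=
  prodFunctional (ev.flip u) (tensorEval₂ ev v w)

variable {ev : W →ₗ[F] Module.Dual F V}

@[simp]
theorem tensorEval₂_tmul (v w : V) (φ ψ : W) :
    tensorEval₂ ev v w (φ ⊗ₜ[F] ψ) = ev φ v * ev ψ w :=
  prodFunctional_tmul _ _ _ _

@[simp]
theorem tensorEval₃_tmul (u v w : V) (φ : W) (t : W ⊗[F] W) :
    tensorEval₃ ev u v w (φ ⊗ₜ[F] t) = ev φ u * tensorEval₂ ev v w t :=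
  prodFunctional_tmul _ _ _ _

theorem eq_zero_of_forall_flip_apply (hev : Function.Injective ev) {φ : W}
    (hφ : ∀ v, ev.flip v φ = 0) : φ = 0 :=
  (map_eq_zero_iff ev hev).mp (LinearMap.ext hφ)

theorem eq_zero_of_forall_tensorEval₂ (hev : Function.Injective ev) {t : W ⊗[F] W}
    (ht : ∀ v w, tensorEval₂ ev v w t = 0) : t = 0 :=
  eq_zero_of_prodFunctional_eq_zero (fun v => ev.flip v) (fun v => ev.flip v)
    (fun _ => eq_zero_of_forall_flip_apply hev) (fun _ => eq_zero_of_forall_flip_apply hev) t ht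

theorem eq_of_forall_tensorEval₃ (hev : Function.Injective ev) {s t : W ⊗[F] (W ⊗[F] W)}
    (hst : ∀ u v w, tensorEval₃ ev u v w s = tensorEval₃ ev u v w t) : s = t :=
  sub_eq_zero.mp <| eq_zero_of_prodFunctional_eq_zero (fun v => ev.flip v)
    (fun p : V × V => tensorEval₂ ev p.1 p.2) (fun _ => eq_zero_of_forall_flip_apply hev)
    (fun _ hq => eq_zero_of_forall_tensorEval₂ hev fun v w => hq (v, w)) _
    fun u p => by
      rw [map_sub, sub_eq_zero]
      exact hst u p.1 p.2

theorem tensorEval₃_Tfirst (u v w : V) (t : W ⊗[F] (W ⊗[F] W)) :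
    tensorEval₃ ev u v w (Tfirst F t) = tensorEval₃ ev v u w t := by
  refine LinearMap.congr_fun (f := tensorEval₃ ev u v w ∘ₗ Tfirst F) (g := tensorEval₃ ev v u w)
    ?_ t
  ext φ ψ χ
  simp [Tfirst]
  ring

variable {one : V} {c : W →ₗ[F] F}

theorem apply_cLeft (hc : ∀ φ, c φ = ev φ one) (t : W ⊗[F] W) (w : V) :
    ev (cLeft F c t) w = tensorEval₂ ev one w t :=
  LinearMap.congr_fun (f := ev.flip w ∘ₗ cLeft F c)
    (TensorProduct.ext' fun φ ψ => by simp [cLeft, hc]) t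

theorem apply_cRight (hc : ∀ φ, c φ = ev φ one) (t : W ⊗[F] W) (v : V) :
    ev (cRight F c t) v = tensorEval₂ ev v one t :=
  LinearMap.congr_fun (f := ev.flip v ∘ₗ cRight F c)
    (TensorProduct.ext' fun φ ψ => by simp [cRight, hc, mul_comm]) t

variable {mul : ℤ → V →ₗ[F] V →ₗ[F] V} {Δ : ℤ → W →ₗ[F] W ⊗[F] W}

theorem tensorEval₃_comp12
    (hΔ : ∀ (k : ℤ) (φ : W) (v w : V), tensorEval₂ ev v w (Δ k φ) = ev φ (mul k v w))
    (m n : ℤ) (φ : W) (u v w : V) :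
    tensorEval₃ ev u v w (comp12 F Δ m n φ) = ev φ (mul m u (mul n v w)) := by
  rw [← hΔ]
  exact LinearMap.congr_fun (f := tensorEval₃ ev u v w ∘ₗ TensorProduct.map LinearMap.id (Δ n))
    (TensorProduct.ext' fun ψ χ => by simp [hΔ]) (Δ m φ)

theorem tensorEval₃_compR
    (hΔ : ∀ (k : ℤ) (φ : W) (v w : V), tensorEval₂ ev v w (Δ k φ) = ev φ (mul k v w))
    (m n : ℤ) (φ : W) (u v w : V) :
    tensorEval₃ ev u v w (compR F Δ Δ m n φ) = ev φ (mul n (mul m u v) w) := by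
  have hassoc : ∀ (t : W ⊗[F] W) (χ : W),
      tensorEval₃ ev u v w (TensorProduct.assoc F W W W (t ⊗ₜ[F] χ)) =
        tensorEval₂ ev u v t * ev χ w := by
    intro t χ
    exact LinearMap.congr_fun (f := tensorEval₃ ev u v w ∘ₗ
      (TensorProduct.assoc F W W W).toLinearMap ∘ₗ (TensorProduct.mk F (W ⊗[F] W) W).flip χ)
      (g := LinearMap.mulRight F (ev χ w) ∘ₗ tensorEval₂ ev u v)
      (TensorProduct.ext' fun φ ψ => by simp [mul_assoc]) t
  rw [← hΔ]
  exact LinearMap.congr_fun (f := tensorEval₃ ev u v w ∘ₗ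
    (TensorProduct.assoc F W W W).toLinearMap ∘ₗ TensorProduct.map (Δ m) LinearMap.id)
    (TensorProduct.ext' fun ψ χ => by simp [hassoc, hΔ]) (Δ n φ)

theorem hasFiniteSupport_of_eventually_zero {N : Type} [Zero N] {f : ℕ → N} (B : ℤ)
    (hf : ∀ i : ℕ, B < i → f i = 0) : f.HasFiniteSupport := by
  refine (Set.finite_Iic B.toNat).subset fun i hi => ?_
  by_contra hlt
  exact hi (hf i (by simp only [Set.mem_Iic] at hlt; omega))

theorem pair_mulJacobi_left (htrunc : ∀ u v : V, ∃ N : ℤ, ∀ n : ℤ, N < n → mul n u v = 0)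
    (φ : V →ₗ[F] F) (a b c : ℤ) (u v w : V) :
    φ (∑ᶠ i : ℕ, ((-1 : F) ^ i * gchoose F a i) •
        (mul (a + b - i) u (mul (c + i) v w) -
          (-1 : F) ^ a • mul (a + c - i) v (mul (b + i) u w))) =
      ∑ᶠ i : ℕ, ((-1 : F) ^ i * gchoose F a i) •
        (φ (mul (a + b - i) u (mul (c + i) v w)) -
          (-1 : F) ^ a • φ (mul (a + c - i) v (mul (b + i) u w))) := by
  obtain ⟨N₁, h₁⟩ := htrunc v w
  obtain ⟨N₂, h₂⟩ := htrunc u w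
  rw [map_finsum]
  · simp
  · refine hasFiniteSupport_of_eventually_zero (max (N₁ - c) (N₂ - b)) fun i hi => ?_
    rw [h₁ (c + i) (by omega), h₂ (b + i) (by omega)]
    simp

theorem pair_mulJacobi_right (htrunc : ∀ u v : V, ∃ N : ℤ, ∀ n : ℤ, N < n → mul n u v = 0)
    (φ : V →ₗ[F] F) (a b c : ℤ) (u v w : V) :
    φ (∑ᶠ i : ℕ, gchoose F b i • mul (b + c - i) (mul (a + i) u v) w) =
      ∑ᶠ i : ℕ, gchoose F b i • φ (mul (b + c - i) (mul (a + i) u v) w) := by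
  obtain ⟨N, hN⟩ := htrunc u v
  rw [map_finsum]
  · simp
  · refine hasFiniteSupport_of_eventually_zero (N - a) fun i hi => ?_
    rw [hN (a + i) (by omega)]
    simp

theorem tensorEval₃_comulJacobi_left
    (hΔ : ∀ (k : ℤ) (φ : W) (v w : V), tensorEval₂ ev v w (Δ k φ) = ev φ (mul k v w))
    (htrunc : ∀ φ, ∃ N : ℤ, ∀ k : ℤ, k < N → Δ k φ = 0)
    (φ : W) (a b c : ℤ) (u v w : V) :
    tensorEval₃ ev u v w (∑ᶠ i : ℕ, ((-1 : F) ^ i * gchoose F a i) •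
        (comp12 F Δ (a + b - i) (c + i) φ -
          (-1 : F) ^ a • Tfirst F (comp12 F Δ (a + c - i) (b + i) φ))) =
      ∑ᶠ i : ℕ, ((-1 : F) ^ i * gchoose F a i) •
        (ev φ (mul (a + b - i) u (mul (c + i) v w)) -
          (-1 : F) ^ a • ev φ (mul (a + c - i) v (mul (b + i) u w))) := by
  obtain ⟨N, hN⟩ := htrunc φ
  rw [map_finsum]
  · simp [tensorEval₃_Tfirst, tensorEval₃_comp12 hΔ]
  · refine hasFiniteSupport_of_eventually_zero (max (a + b - N) (a + c - N)) fun i hi => ?_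
    simp [comp12, hN (a + b - i) (by omega), hN (a + c - i) (by omega)]

theorem tensorEval₃_comulJacobi_right
    (hΔ : ∀ (k : ℤ) (φ : W) (v w : V), tensorEval₂ ev v w (Δ k φ) = ev φ (mul k v w))
    (htrunc : ∀ φ, ∃ N : ℤ, ∀ k : ℤ, k < N → Δ k φ = 0)
    (φ : W) (a b c : ℤ) (u v w : V) :
    tensorEval₃ ev u v w
        (∑ᶠ i : ℕ, gchoose F b i • compR F Δ Δ (a + i) (b + c - i) φ) =
      ∑ᶠ i : ℕ, gchoose F b i • ev φ (mul (b + c - i) (mul (a + i) u v) w) := by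
  obtain ⟨N, hN⟩ := htrunc φ
  rw [map_finsum]
  · simp [tensorEval₃_compR hΔ]
  · refine hasFiniteSupport_of_eventually_zero (b + c - N) fun i hi => ?_
    simp [compR, hN (b + c - i) (by omega)]

theorem vaJacobi_iff_jacobiId (hev : Function.Injective ev)
    (hsep : ∀ v, (∀ φ, ev φ v = 0) → v = 0)
    (htrunc : ∀ u v : V, ∃ N : ℤ, ∀ n : ℤ, N < n → mul n u v = 0)
    (htrunc' : ∀ φ, ∃ N : ℤ, ∀ k : ℤ, k < N → Δ k φ = 0)
    (hΔ : ∀ (k : ℤ) (φ : W) (v w : V), tensorEval₂ ev v w (Δ k φ) = ev φ (mul k v w)) :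
    VAJacobi F mul ↔ JacobiId F Δ Δ := by
  constructor
  · intro hJ a b c φ
    refine eq_of_forall_tensorEval₃ hev fun u v w => ?_
    rw [tensorEval₃_comulJacobi_left hΔ htrunc', tensorEval₃_comulJacobi_right hΔ htrunc',
      ← pair_mulJacobi_left htrunc, ← pair_mulJacobi_right htrunc, hJ]
  · intro hJ a b c u v w
    refine sub_eq_zero.mp <| hsep _ fun φ => ?_
    rw [map_sub, sub_eq_zero, pair_mulJacobi_left htrunc, pair_mulJacobi_right htrunc,
      ← tensorEval₃_comulJacobi_left hΔ htrunc', ← tensorEval₃_comulJacobi_right hΔ htrunc', hJ]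

end Pairing

section GradedDual

variable {F} {gr : ℤ → Submodule F V}

/-- Linear maps that agree on every homogeneous component are equal. -/
theorem DirectSum.IsInternal.linearMap_ext (h : DirectSum.IsInternal gr) {f g : V →ₗ[F] M}
    (hfg : ∀ k, ∀ v ∈ gr k, f v = g v) : f = g := by
  have hle : ⨆ k, gr k ≤ LinearMap.eqLocus f g := iSup_le hfg
  rw [h.submodule_iSup_eq_top] at hle
  exact LinearMap.ext fun v => hle (Submodule.mem_top (x := v))

/-- The projection of `V` onto its weight-`k` component. -/
def homogeneousProj (h : DirectSum.IsInternal gr) (k : ℤ) : V →ₗ[F] V :=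
  (gr k).subtype ∘ₗ DirectSum.component F ℤ (fun i => gr i) k ∘ₗ
    (LinearEquiv.ofBijective (DirectSum.coeLinearMap gr) h).symm.toLinearMap

theorem homogeneousProj_apply_of_mem (h : DirectSum.IsInternal gr) (k : ℤ) {j : ℤ} {v : V}
    (hv : v ∈ gr j) : homogeneousProj h k v = if j = k then v else 0 := by
  have hsymm : (LinearEquiv.ofBijective (DirectSum.coeLinearMap gr) h).symm v =
      DirectSum.lof F ℤ (fun i => gr i) j ⟨v, hv⟩ := by
    rw [LinearEquiv.symm_apply_eq]
    exact (DirectSum.coeLinearMap_lof gr j ⟨v, hv⟩).symm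
  simp only [homogeneousProj, LinearMap.comp_apply, LinearEquiv.coe_coe, hsymm]
  split_ifs with hjk
  · subst hjk
    simp
  · rw [DirectSum.component.of, dif_neg hjk, map_zero]

/-- The truncation of a functional to the weight-`k` component. -/
def dualProj (h : DirectSum.IsInternal gr) (k : ℤ) :
    gradedDual F gr →ₗ[F] gradedDualPiece F gr k where
  toFun φ := ⟨⟨φ.1 ∘ₗ homogeneousProj h k, {k}, fun j hj v hv => by
      simp [homogeneousProj_apply_of_mem h k hv, Finset.notMem_singleton.mp hj]⟩,
    fun j hj v hv => by simp [homogeneousProj_apply_of_mem h k hv, hj]⟩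
  map_add' _ _ := rfl
  map_smul' _ _ := rfl

theorem dualProj_apply_apply (h : DirectSum.IsInternal gr) (k : ℤ) (φ : gradedDual F gr) (v : V) :
    (dualProj h k φ).1.1 v = φ.1 (homogeneousProj h k v) := rfl

theorem dualProj_apply_of_mem (h : DirectSum.IsInternal gr) (k : ℤ) (φ : gradedDual F gr)
    {j : ℤ} {v : V} (hv : v ∈ gr j) : (dualProj h k φ).1.1 v = if j = k then φ.1 v else 0 := by
  rw [dualProj_apply_apply, homogeneousProj_apply_of_mem h k hv]
  split_ifs <;> simp

theorem gradedDual_ext (h : DirectSum.IsInternal gr) {φ ψ : gradedDual F gr}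
    (hφψ : ∀ k, ∀ v ∈ gr k, φ.1 v = ψ.1 v) : φ = ψ :=
  Subtype.ext (h.linearMap_ext hφψ)

theorem eventually_sum_dualProj (h : DirectSum.IsInternal gr) (φ : gradedDual F gr) :
    ∀ᶠ s : Finset ℤ in Filter.atTop, ∑ k ∈ s, (dualProj h k φ).1 = φ := by
  obtain ⟨s, hs⟩ := φ.2
  filter_upwards [Filter.eventually_ge_atTop s] with t ht
  refine gradedDual_ext h fun j v hv => ?_
  simp only [AddSubmonoidClass.coe_finsetSum, LinearMap.sum_apply]
  rw [Finset.sum_congr rfl fun k _ => dualProj_apply_of_mem h k φ hv, Finset.sum_ite_eq]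
  split_ifs with hj
  · rfl
  · exact (hs j (fun hjs => hj (ht hjs)) v hv).symm

/-- The graded dual separates the points of `V`. -/
theorem eq_zero_of_forall_gradedDual (h : DirectSum.IsInternal gr) {v : V}
    (hv : ∀ φ : gradedDual F gr, φ.1 v = 0) : v = 0 := by
  have hproj : ∀ k, homogeneousProj h k v = 0 := by
    intro k
    rw [← Module.forall_dual_apply_eq_zero_iff F]
    intro f
    exact hv ⟨f ∘ₗ homogeneousProj h k, {k}, fun j hj u hu => by
      simp [homogeneousProj_apply_of_mem h k hu, Finset.notMem_singleton.mp hj]⟩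
  rw [← (LinearEquiv.ofBijective (DirectSum.coeLinearMap gr) h).symm.map_eq_zero_iff]
  ext k
  exact hproj k

theorem isInternal_gradedDualPiece (h : DirectSum.IsInternal gr) :
    DirectSum.IsInternal (gradedDualPiece F gr) := by
  refine DirectSum.isInternal_submodule_of_iSupIndep_of_iSup_eq_top (M := gradedDual F gr) ?_ ?_
  · refine iSupIndep_def.mpr fun i => Submodule.disjoint_def.mpr fun φ hφ hφ' => ?_
    have hker : ⨆ j, ⨆ (_ : j ≠ i), gradedDualPiece F gr j ≤
        LinearMap.ker ((gr i).subtype.dualMap ∘ₗ (gradedDual F gr).subtype) :=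
      iSup₂_le fun j hj ψ hψ => LinearMap.ext fun v => hψ i hj.symm v v.2
    refine gradedDual_ext h fun k v hv => ?_
    by_cases hk : k = i
    · subst hk
      exact LinearMap.congr_fun (hker hφ') ⟨v, hv⟩
    · exact hφ k hk v hv
  · refine eq_top_iff.mpr fun φ _ => ?_
    obtain ⟨s, hs⟩ := (eventually_sum_dualProj h φ).exists
    rw [← hs]
    exact Submodule.sum_mem _ fun k _ => Submodule.mem_iSup_of_mem k (dualProj h k φ).2

theorem pairVV_apply (t : gradedDual F gr ⊗[F] gradedDual F gr) (v w : V) :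
    pairVV F gr t (v ⊗ₜ[F] w) =
      tensorEval₂ (W := gradedDual F gr) (gradedDual F gr).subtype v w t :=
  LinearMap.congr_fun (f := LinearMap.applyₗ (v ⊗ₜ[F] w) ∘ₗ pairVV F gr)
    (TensorProduct.ext' fun φ ψ => by simp [pairVV]) t

theorem eq_zero_of_forall_homogeneous_pairVV (h : DirectSum.IsInternal gr)
    {t : gradedDual F gr ⊗[F] gradedDual F gr}
    (ht : ∀ j k, ∀ v ∈ gr j, ∀ w ∈ gr k, pairVV F gr t (v ⊗ₜ[F] w) = 0) : t = 0 := by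
  have hzero : TensorProduct.curry (pairVV F gr t) = 0 :=
    h.linearMap_ext fun j v hv => h.linearMap_ext fun k w hw => ht j k v hv w hw
  refine eq_zero_of_forall_tensorEval₂ (W := gradedDual F gr)
    (ev := (gradedDual F gr).subtype) Subtype.val_injective fun v w => ?_
  rw [← pairVV_apply]
  exact LinearMap.congr_fun (LinearMap.congr_fun hzero v) w

theorem eventually_sum_map_dualProj (h : DirectSum.IsInternal gr)
    (t : gradedDual F gr ⊗[F] gradedDual F gr) :
    ∀ᶠ s : Finset ℤ in Filter.atTop, ∑ p ∈ s, ∑ q ∈ s,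
      TensorProduct.map (gradedDualPiece F gr p).subtype (gradedDualPiece F gr q).subtype
        (TensorProduct.map (dualProj h p) (dualProj h q) t) = t := by
  induction t using TensorProduct.induction_on with
  | zero => simp
  | tmul φ ψ =>
    filter_upwards [eventually_sum_dualProj h φ, eventually_sum_dualProj h ψ] with s hφ hψ
    simp only [TensorProduct.map_tmul, Submodule.subtype_apply]
    simp only [← TensorProduct.tmul_sum, ← TensorProduct.sum_tmul, hφ, hψ]
  | add x y hx hy =>
    filter_upwards [hx, hy] with s hx hy
    simp only [map_add, Finset.sum_add_distrib, hx, hy]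

theorem mem_grT2_gradedDualPiece (h : DirectSum.IsInternal gr) (m : ℤ)
    (t : gradedDual F gr ⊗[F] gradedDual F gr)
    (ht : ∀ j k, j + k ≠ m → ∀ v ∈ gr j, ∀ w ∈ gr k, pairVV F gr t (v ⊗ₜ[F] w) = 0) :
    t ∈ grT2 (V := gradedDual F gr) F (gradedDualPiece F gr) m := by
  obtain ⟨s, hs⟩ := (eventually_sum_map_dualProj h t).exists
  rw [← hs]
  refine Submodule.sum_mem _ fun p _ => Submodule.sum_mem _ fun q _ => ?_
  by_cases hpq : p + q = m
  · obtain rfl : q = m - p := by omega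
    exact Submodule.mem_iSup_of_mem p (LinearMap.mem_range_self _ _)
  · have hproj : ∀ v w, pairVV F gr
        (TensorProduct.map (gradedDualPiece F gr p).subtype (gradedDualPiece F gr q).subtype
          (TensorProduct.map (dualProj h p) (dualProj h q) t)) (v ⊗ₜ[F] w) =
        pairVV F gr t (homogeneousProj h p v ⊗ₜ[F] homogeneousProj h q w) := by
      intro v w
      rw [pairVV_apply, pairVV_apply]
      exact LinearMap.congr_fun
        (f := tensorEval₂ (W := gradedDual F gr) (gradedDual F gr).subtype v w ∘ₗ
          TensorProduct.map (gradedDualPiece F gr p).subtype (gradedDualPiece F gr q).subtype ∘ₗ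
          TensorProduct.map (dualProj h p) (dualProj h q))
        (TensorProduct.ext' fun φ ψ => by simp [dualProj_apply_apply]) t
    rw [eq_zero_of_forall_homogeneous_pairVV h (t := TensorProduct.map _ _ _)]
    · exact Submodule.zero_mem _
    · intro j k v hv w hw
      rw [hproj, homogeneousProj_apply_of_mem h p hv, homogeneousProj_apply_of_mem h q hw]
      split_ifs with hj hk
      · exact ht j k (by omega) v hv w hw
      all_goals simp

end GradedDual

section Duality

variable {F} {gr : ℤ → Submodule F V} {mul : ℤ → V →ₗ[F] V →ₗ[F] V}

theorem mul_truncation (h : DirectSum.IsInternal gr) (hbdd : ∃ N : ℤ, ∀ k : ℤ, k < N → gr k = ⊥)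
    (hgrmul : ∀ (j k n : ℤ), ∀ u ∈ gr j, ∀ v ∈ gr k, mul n u v ∈ gr (j + k - n - 1)) (u v : V) :
    ∃ N : ℤ, ∀ n : ℤ, N < n → mul n u v = 0 := by
  obtain ⟨B, hB⟩ := hbdd
  have htop : ∀ v : V, v ∈ ⨆ k, gr k := fun v => by
    rw [h.submodule_iSup_eq_top]
    trivial
  induction htop u using Submodule.iSup_induction' with
  | zero => exact ⟨0, by simp⟩
  | add x y _ _ hx hy =>
    obtain ⟨N₁, h₁⟩ := hx
    obtain ⟨N₂, h₂⟩ := hy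
    exact ⟨max N₁ N₂, fun n hn => by
      rw [map_add, LinearMap.add_apply, h₁ n (by omega), h₂ n (by omega), add_zero]⟩
  | mem j u hu =>
    induction htop v using Submodule.iSup_induction' with
    | zero => exact ⟨0, by simp⟩
    | add x y _ _ hx hy =>
      obtain ⟨N₁, h₁⟩ := hx
      obtain ⟨N₂, h₂⟩ := hy
      exact ⟨max N₁ N₂, fun n hn => by
        rw [map_add, h₁ n (by omega), h₂ n (by omega), add_zero]⟩
    | mem k v hv =>
      refine ⟨j + k - 1 - B, fun n hn => ?_⟩
      have := hgrmul j k n u hu v hv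
      rwa [hB _ (by omega), Submodule.mem_bot] at this

variable {Δ' : ℤ → gradedDual F gr →ₗ[F] gradedDual F gr ⊗[F] gradedDual F gr}

theorem coproduct_truncation (h : DirectSum.IsInternal gr)
    (hbdd : ∃ N : ℤ, ∀ k : ℤ, k < N → gr k = ⊥)
    (hgrmul : ∀ (j k n : ℤ), ∀ u ∈ gr j, ∀ v ∈ gr k, mul n u v ∈ gr (j + k - n - 1))
    (hΔ' : ∀ (k : ℤ) (φ : gradedDual F gr) (v w : V),
      pairVV F gr (Δ' k φ) (v ⊗ₜ[F] w) = φ.1 (mul k v w)) (φ : gradedDual F gr) :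
    ∃ N : ℤ, ∀ k : ℤ, k < N → Δ' k φ = 0 := by
  obtain ⟨B, hB⟩ := hbdd
  obtain ⟨s, hs⟩ := φ.2
  obtain ⟨C, hC⟩ := s.bddAbove
  refine ⟨B + B - C - 1, fun k hk => eq_zero_of_forall_homogeneous_pairVV h ?_⟩
  intro i j v hv w hw
  rw [hΔ']
  by_cases hi : i < B
  · rw [hB i hi, Submodule.mem_bot] at hv
    simp [hv]
  by_cases hj : j < B
  · rw [hB j hj, Submodule.mem_bot] at hw
    simp [hw]
  refine hs _ (fun hmem => ?_) _ (hgrmul i j k v hv w hw)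
  have := hC hmem
  omega

theorem isGradedVC_gradedDual (h : DirectSum.IsInternal gr)
    (hbdd : ∃ N : ℤ, ∀ k : ℤ, k < N → gr k = ⊥)
    (hgrmul : ∀ (j k n : ℤ), ∀ u ∈ gr j, ∀ v ∈ gr k, mul n u v ∈ gr (j + k - n - 1))
    (hΔ' : ∀ (k : ℤ) (φ : gradedDual F gr) (v w : V),
      pairVV F gr (Δ' k φ) (v ⊗ₜ[F] w) = φ.1 (mul k v w)) :
    IsGradedVC (V := gradedDual F gr) F Δ' (gradedDualPiece F gr) := by
  refine ⟨isInternal_gradedDualPiece h, ?_, fun r k φ hφ => mem_grT2_gradedDualPiece h _ _ ?_⟩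
  · obtain ⟨B, hB⟩ := hbdd
    refine ⟨B, fun k hk => (Submodule.eq_bot_iff _).mpr fun φ hφ => gradedDual_ext h ?_⟩
    intro j v hv
    by_cases hj : j = k
    · rw [hj, hB k hk, Submodule.mem_bot] at hv
      simp [hv]
    · exact hφ j hj v hv
  · intro i j hij v hv w hw
    rw [hΔ']
    exact hφ _ (by omega) _ (hgrmul i j k v hv w hw)

end Duality

/-- Duality between graded vertex algebras and graded vertex
coalgebras: Let `V` be a `ℤ`-graded vector space bounded below (with internal
grading `gr`), `1 ∈ V₍₀₎`, and `Y` (encoded by `mul`) satisfying the weight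
condition `uₙv ∈ V₍ⱼ₊ₖ₋ₙ₋₁₎`.  Let `V'` be the graded dual, `c(u') = u'(1)`, and
let `Y'` (encoded by `Δ'`) be defined by `⟨Y'(x)u', v ⊗ w⟩ = ⟨u', Y(v,x)w⟩`.
Then `(V, Y, 1)` is a graded vertex algebra if and only if `(V', Y', c)` is a
graded vertex coalgebra. -/
theorem duality_graded_VA_VC
    (gr : ℤ → Submodule F V) (one : V) (mul : ℤ → V →ₗ[F] V →ₗ[F] V)
    (hinternal : DirectSum.IsInternal gr)
    (hbdd : ∃ N : ℤ, ∀ k : ℤ, k < N → gr k = ⊥)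
    (hone : one ∈ gr 0)
    (hgrmul : ∀ (j k n : ℤ), ∀ u ∈ gr j, ∀ v ∈ gr k, mul n u v ∈ gr (j + k - n - 1))
    (Δ' : ℤ → ↥(gradedDual F gr) →ₗ[F] ↥(gradedDual F gr) ⊗[F] ↥(gradedDual F gr))
    (hΔ' : ∀ (k : ℤ) (φ : ↥(gradedDual F gr)) (v w : V),
      pairVV F gr (Δ' k φ) (v ⊗ₜ[F] w) = (φ : Module.Dual F V) (mul k v w)) :
    IsVA F mul one ↔
      (IsVertexCoalg (V := ↥(gradedDual F gr)) F Δ' (covac F gr one) ∧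
        IsGradedVC (V := ↥(gradedDual F gr)) F Δ' (gradedDualPiece F gr)) := by
  have hΔ : ∀ k φ v w, tensorEval₂ (W := gradedDual F gr) (gradedDual F gr).subtype v w (Δ' k φ) =
      (gradedDual F gr).subtype φ (mul k v w) := fun k φ v w => by
    rw [← pairVV_apply, hΔ']
    rfl
  have hsep : ∀ v : V, (∀ φ, (gradedDual F gr).subtype φ v = 0) → v = 0 :=
    fun v => eq_zero_of_forall_gradedDual hinternal
  have htrunc := mul_truncation hinternal hbdd hgrmul
  have htrunc' := coproduct_truncation hinternal hbdd hgrmul hΔ'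
  have hJ := vaJacobi_iff_jacobiId (W := gradedDual F gr) Subtype.val_injective hsep htrunc
    htrunc' hΔ
  have hc : ∀ φ, covac F gr one φ = (gradedDual F gr).subtype φ one := fun _ => rfl
  have hleft := fun k φ w => (apply_cLeft (W := gradedDual F gr) hc (Δ' k φ) w).trans
    (hΔ k φ one w)
  have hright := fun k φ v => (apply_cRight (W := gradedDual F gr) hc (Δ' k φ) v).trans
    (hΔ k φ v one)
  constructor
  · rintro ⟨-, hvac, hvac', hcre, hcre', hjac⟩
    refine ⟨⟨⟨fun φ => ?_, fun k hk φ => ?_, fun φ => ?_, fun k hk φ => ?_, htrunc'⟩,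
      hJ.mp hjac⟩, isGradedVC_gradedDual hinternal hbdd hgrmul hΔ'⟩
    all_goals refine Subtype.ext (LinearMap.ext fun v => ?_)
    · exact (hleft _ φ v).trans (by rw [hvac]; rfl)
    · exact (hleft _ φ v).trans (by rw [hvac' k hk, map_zero]; rfl)
    · exact (hright _ φ v).trans (by rw [hcre]; rfl)
    · exact (hright _ φ v).trans (by rw [hcre' k hk, map_zero]; rfl)
  · rintro ⟨⟨⟨hvac, hvac', hcre, hcre', -⟩, hjac⟩, -⟩
    refine ⟨htrunc, fun v => ?_, fun k hk v => ?_, fun v => ?_, fun k hk v => ?_, hJ.mpr hjac⟩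
    · refine sub_eq_zero.mp <| hsep _ fun φ => ?_
      rw [map_sub, sub_eq_zero, ← hleft, hvac]
    · refine hsep _ fun φ => ?_
      rw [← hleft, hvac' k hk, map_zero, LinearMap.zero_apply]
    · refine sub_eq_zero.mp <| hsep _ fun φ => ?_
      rw [map_sub, sub_eq_zero, ← hright, hcre]
    · refine hsep _ fun φ => ?_
      rw [← hright, hcre' k hk, map_zero, LinearMap.zero_apply]
end
end
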